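/- arXiv:2403.03453 — 2 statements merged into one kernel-verified Lean document; each statement's English description precedes it below -/
import Mathlib

section
/- Let 1 < p < ∞ with p ≠ 2, and let Y be a finite-dimensional linear subspace of ℓ_p. Then Y has property-(SU) in ℓ_p if and only if Y is isometrically isomorphic to ℓ_p(dim Y). -/
open scoped ENNReal

noncomputable section

/-- The annihilator of a subspace `Y` in the continuous dual. -/
def annih {X : Type*} [NormedAddCommGroup X] [NormedSpace ℝ X] (Y : Submodule ℝ X) :
    Submodule ℝ (X →L[ℝ] ℝ) where
  carrier := {f | ∀ y ∈ Y, f y = 0}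
  add_mem' := by intro f g hf hg y hy; simp [hf y hy, hg y hy]
  zero_mem' := by intro y hy; simp
  smul_mem' := by intro c f hf y hy; simp [hf y hy]

/-- `F` is a norm-preserving extension of `f : Y* → ℝ`. -/
def IsNPExtension {X : Type*} [NormedAddCommGroup X] [NormedSpace ℝ X] (Y : Submodule ℝ X)
    (f : Y →L[ℝ] ℝ) (F : X →L[ℝ] ℝ) : Prop :=
  (∀ y : Y, F y = f y) ∧ ‖F‖ = ‖f‖

/-- property-(U) -/
def PropU {X : Type*} [NormedAddCommGroup X] [NormedSpace ℝ X] (Y : Submodule ℝ X) : Prop :=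
  ∀ f : Y →L[ℝ] ℝ, ∃! F : X →L[ℝ] ℝ, IsNPExtension Y f F

/-- property-(wU) -/
def PropwU {X : Type*} [NormedAddCommGroup X] [NormedSpace ℝ X] (Y : Submodule ℝ X) : Prop :=
  ∀ f : Y →L[ℝ] ℝ, (∃ y₀ : Y, ‖y₀‖ = 1 ∧ ‖f‖ = |f y₀|) →
    ∃! F : X →L[ℝ] ℝ, IsNPExtension Y f F

/-- property-(SU) -/
def PropSU {X : Type*} [NormedAddCommGroup X] [NormedSpace ℝ X] (Y : Submodule ℝ X) : Prop :=
  ∃ G : Submodule ℝ (X →L[ℝ] ℝ), IsClosed (G : Set (X →L[ℝ] ℝ)) ∧ IsCompl G (annih Y) ∧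
    ∀ g ∈ G, ∀ h ∈ annih Y, h ≠ 0 → ‖g‖ < ‖g + h‖

/-- property-(HB) -/
def PropHB {X : Type*} [NormedAddCommGroup X] [NormedSpace ℝ X] (Y : Submodule ℝ X) : Prop :=
  ∃ G : Submodule ℝ (X →L[ℝ] ℝ), IsClosed (G : Set (X →L[ℝ] ℝ)) ∧ IsCompl G (annih Y) ∧
    ∀ g ∈ G, ∀ h ∈ annih Y, h ≠ 0 → ‖g‖ < ‖g + h‖ ∧ ‖h‖ ≤ ‖g + h‖

/-- M-ideal -/
def MIdeal {X : Type*} [NormedAddCommGroup X] [NormedSpace ℝ X] (Y : Submodule ℝ X) : Prop :=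
  ∃ G : Submodule ℝ (X →L[ℝ] ℝ), IsClosed (G : Set (X →L[ℝ] ℝ)) ∧ IsCompl G (annih Y) ∧
    ∀ g ∈ G, ∀ h ∈ annih Y, ‖g + h‖ = ‖g‖ + ‖h‖


def psi (P t : ℝ) : ℝ := |t| ^ (P - 2) * t

lemma psi_zero (P : ℝ) : psi P 0 = 0 := by simp [psi]

lemma psi_one (P : ℝ) : psi P 1 = 1 := by simp [psi]

lemma psi_mul (P a b : ℝ) : psi P (a * b) = psi P a * psi P b := by
  unfold psi
  rw [abs_mul, Real.mul_rpow (abs_nonneg _) (abs_nonneg _)]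
  ring

lemma psi_ne_zero (P : ℝ) {a : ℝ} (ha : a ≠ 0) : psi P a ≠ 0 := by
  unfold psi
  have := Real.rpow_pos_of_pos (abs_pos.2 ha) (P - 2)
  positivity

lemma psi_two {P : ℝ} (hP : P ≠ 2) : psi P 2 ≠ 2 := by
  unfold psi
  intro h
  have h2 : |(2:ℝ)| ^ (P - 2) = 1 := by linarith
  rw [abs_of_pos (by norm_num : (0:ℝ) < 2)] at h2
  rw [← Real.rpow_zero (2:ℝ), Real.rpow_right_inj (by norm_num) (by norm_num)] at h2
  exact hP (by linarith)

lemma psi_surj {P : ℝ} (hP : 1 < P) (c : ℝ) : ∃ d, psi P d = c := by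
  by_cases hc : c = 0
  · exact ⟨0, by rw [psi_zero, hc]⟩
  have hc' : 0 < |c| := abs_pos.2 hc
  have hP' : P - 1 ≠ 0 := by linarith
  refine ⟨|c| ^ (1 / (P - 1) - 1) * c, ?_⟩
  unfold psi
  have h1 : |(|c| ^ (1 / (P - 1) - 1) * c)| = |c| ^ (1 / (P - 1)) := by
    rw [abs_mul, abs_of_pos (Real.rpow_pos_of_pos hc' _)]
    nth_rewrite 2 [← Real.rpow_one |c|]
    rw [← Real.rpow_add hc']
    congr 1; ring
  rw [h1, ← Real.rpow_mul hc'.le, ← mul_assoc, ← Real.rpow_add hc']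
  have : 1 / (P - 1) * (P - 2) + (1 / (P - 1) - 1) = 0 := by
    field_simp; ring
  rw [this, Real.rpow_zero, one_mul]

lemma disj_sum {ι : Type*} [Fintype ι] (a c : ι → ℝ) (ha : ∀ i j, i ≠ j → a i * a j = 0)
    (f : ℝ → ℝ) (hf : f 0 = 0) : f (∑ i, c i * a i) = ∑ i, f (c i * a i) := by
  classical
  by_cases h : ∃ i, a i ≠ 0
  · obtain ⟨i, hi⟩ := h
    have hz : ∀ j, j ≠ i → a j = 0 := fun j hj => by
      have := ha j i hj
      simpa [hi] using this
    rw [Finset.sum_eq_single i (fun j _ hj => by simp [hz j hj]) (by simp),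
      Finset.sum_eq_single i (fun j _ hj => by simp [hz j hj, hf]) (by simp)]
  · push Not at h
    simp [h, hf]

/-- sign-definite Clarkson -/
lemma clarkson_aux {P : ℝ} (hP : 1 < P) (hP2 : P ≠ 2) :
    ∃ ε : ℝ, ε ≠ 0 ∧ (∀ s t : ℝ, 0 ≤ ε * (|s + t| ^ P + |s - t| ^ P - 2 * |s| ^ P - 2 * |t| ^ P)) ∧
      ∀ s t : ℝ, s * t ≠ 0 →
        0 < ε * (|s + t| ^ P + |s - t| ^ P - 2 * |s| ^ P - 2 * |t| ^ P) := by
  have key : ∀ x : ℝ, |x| ^ P = (x ^ 2) ^ (P / 2) := fun x => by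
    rw [← sq_abs, ← Real.rpow_natCast, ← Real.rpow_mul (abs_nonneg _)]
    congr 1; push_cast; ring
  have main : ∃ ε : ℝ, ε ≠ 0 ∧ ∀ s t : ℝ, s * t ≠ 0 →
        0 < ε * (|s + t| ^ P + |s - t| ^ P - 2 * |s| ^ P - 2 * |t| ^ P) := by
    have e : ∀ s t : ℝ, (2:ℝ)⁻¹ * (s + t) ^ 2 + (2:ℝ)⁻¹ * (s - t) ^ 2 = s ^ 2 + t ^ 2 := by
      intros; ring
    have ne : ∀ s t : ℝ, s * t ≠ 0 → (s + t) ^ 2 ≠ (s - t) ^ 2 := by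
      intro s t h h'
      apply h; nlinarith
    rcases lt_or_gt_of_ne hP2 with h | h
    · refine ⟨-1, by norm_num, fun s t hst => ?_⟩
      have h1 := (Real.strictConcaveOn_rpow (p := P / 2) (by linarith) (by linarith)).2
        (Set.mem_Ici.2 (sq_nonneg (s + t)))
        (Set.mem_Ici.2 (sq_nonneg (s - t))) (ne s t hst)
        (by norm_num : (0:ℝ) < 2⁻¹) (by norm_num : (0:ℝ) < 2⁻¹) (by norm_num)
      have h2 := Real.rpow_add_le_add_rpow (sq_nonneg s) (sq_nonneg t)
        (p := P / 2) (by linarith) (by linarith)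
      simp only [smul_eq_mul, e] at h1
      simp only [key]
      linarith
    · refine ⟨1, by norm_num, fun s t hst => ?_⟩
      have h1 := (strictConvexOn_rpow (p := P / 2) (by linarith)).2
        (Set.mem_Ici.2 (sq_nonneg (s + t)))
        (Set.mem_Ici.2 (sq_nonneg (s - t))) (ne s t hst)
        (by norm_num : (0:ℝ) < 2⁻¹) (by norm_num : (0:ℝ) < 2⁻¹) (by norm_num)
      have h2 := Real.add_rpow_le_rpow_add (sq_nonneg s) (sq_nonneg t)
        (p := P / 2) (by linarith)
      simp only [smul_eq_mul, e] at h1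
      simp only [key]
      linarith
  obtain ⟨ε, h0, h⟩ := main
  refine ⟨ε, h0, fun s t => ?_, h⟩
  by_cases hst : s * t = 0
  · have hP0 : P ≠ 0 := by linarith
    rcases mul_eq_zero.1 hst with rfl | rfl
    · simp [Real.zero_rpow hP0]; ring_nf; simp
    · simp [Real.zero_rpow hP0]; ring_nf; simp
  · exact (h s t hst).le

section lpfacts

variable {p : ℝ≥0∞} [Fact (1 ≤ p)]

lemma lp_ext (hptop : p ≠ ⊤) {F F' : lp (fun _ : ℕ => ℝ) p →L[ℝ] ℝ}
    (h : ∀ k, F (lp.single p k (1:ℝ)) = F' (lp.single p k (1:ℝ))) : F = F' := by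
  ext x
  have h0 := lp.hasSum_single hptop x
  have h1 := h0.mapL F
  have h2 := h0.mapL F'
  refine h1.unique ?_
  convert h2 using 2 with k
  have : lp.single p k (x k) = (x k) • lp.single (E := fun _ : ℕ => ℝ) p k (1:ℝ) := by
    rw [← lp.single_smul]; simp
  simp only [this, map_smul, h k]

lemma lp_hasSum (hptop : p ≠ ⊤) (F : lp (fun _ : ℕ => ℝ) p →L[ℝ] ℝ) (x : lp (fun _ : ℕ => ℝ) p) :
    HasSum (fun k => x k * F (lp.single p k (1:ℝ))) (F x) := by
  have h1 := (lp.hasSum_single hptop x).mapL F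
  convert h1 using 2 with k
  have : lp.single p k (x k) = (x k) • lp.single (E := fun _ : ℕ => ℝ) p k (1:ℝ) := by
    rw [← lp.single_smul]; simp
  simp only [this, map_smul, smul_eq_mul]

lemma lp_norm_line (hP : 0 < p.toReal) (y : lp (fun _ : ℕ => ℝ) p) (k : ℕ) (t : ℝ) :
    ‖y + t • lp.single (E := fun _ : ℕ => ℝ) p k (1:ℝ)‖
      = (‖y‖ ^ p.toReal + |y k + t| ^ p.toReal - |y k| ^ p.toReal) ^ (1 / p.toReal) := by
  have h1 := lp.hasSum_norm hP y
  have h2 := lp.hasSum_norm hP (y + t • lp.single (E := fun _ : ℕ => ℝ) p k (1:ℝ))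
  have h3 := h1.update k (|y k + t| ^ p.toReal)
  have h4 : (fun i => ‖(y + t • lp.single (E := fun _ : ℕ => ℝ) p k (1:ℝ)) i‖ ^ p.toReal)
      = Function.update (fun i => ‖y i‖ ^ p.toReal) k (|y k + t| ^ p.toReal) := by
    funext i
    have e : (y + t • lp.single (E := fun _ : ℕ => ℝ) p k (1:ℝ)) i
      = y i + t * (Pi.single k (1:ℝ) : ℕ → ℝ) i := rfl
    rw [e]
    by_cases hi : i = k
    · subst hi
      simp
    · simp [hi]
  rw [h4] at h2
  have h5 := h2.unique h3
  have h6 : ‖y + t • lp.single (E := fun _ : ℕ => ℝ) p k (1:ℝ)‖ ^ p.toReal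
    = ‖y‖ ^ p.toReal + |y k + t| ^ p.toReal - |y k| ^ p.toReal := by
    rw [h5, Real.norm_eq_abs]; ring
  rw [← h6, one_div, Real.rpow_rpow_inv (norm_nonneg _) hP.ne']

lemma lp_deriv (hP : 1 < p.toReal) (F : lp (fun _ : ℕ => ℝ) p →L[ℝ] ℝ)
    (y : lp (fun _ : ℕ => ℝ) p) (hy : y ≠ 0) (hF : F y = ‖F‖ * ‖y‖) (k : ℕ) :
    F (lp.single p k (1:ℝ)) =
      ‖F‖ * (‖y‖ ^ p.toReal) ^ (1 / p.toReal - 1) * psi p.toReal (y k) := by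
  set P := p.toReal with hPdef
  have hN : 0 < ‖y‖ ^ P := Real.rpow_pos_of_pos (norm_pos_iff.2 hy) _
  set c := F (lp.single p k (1:ℝ)) with hc
  have hd1 : HasDerivAt (fun t : ℝ => |y k + t| ^ P) (P * |y k + 0| ^ (P - 2) * (y k + 0)) 0 := by
    have := (hasDerivAt_abs_rpow (y k + 0) hP).comp (0:ℝ) ((hasDerivAt_id (0:ℝ)).const_add (y k))
    simpa [Function.comp_def] using this
  have hd2 : HasDerivAt (fun t : ℝ => ‖y‖ ^ P + |y k + t| ^ P - |y k| ^ P)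
      (P * |y k + 0| ^ (P - 2) * (y k + 0)) 0 := (hd1.const_add _).sub_const _
  have hd3 := hd2.rpow_const (p := 1 / P) (Or.inl (by simpa using hN.ne'))
  have hd4 := (hd3.const_mul ‖F‖).sub (((hasDerivAt_id (0:ℝ)).mul_const c).const_add (F y))
  have hmin : IsLocalMin (fun t : ℝ => ‖F‖ * (‖y‖ ^ P + |y k + t| ^ P - |y k| ^ P) ^ (1 / P)
      - (F y + id t * c)) 0 := by
    refine Filter.Eventually.of_forall fun t => ?_
    have l := lp_norm_line (by linarith : 0 < P) y k
    rw [← hPdef] at l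
    have l0 := l 0
    rw [zero_smul, add_zero] at l0
    show ‖F‖ * (‖y‖ ^ P + |y k + 0| ^ P - |y k| ^ P) ^ (1 / P) - (F y + 0 * c) ≤
      ‖F‖ * (‖y‖ ^ P + |y k + t| ^ P - |y k| ^ P) ^ (1 / P) - (F y + t * c)
    rw [← l t, ← l0]
    have := (le_abs_self _).trans (F.le_opNorm (y + t • lp.single (E := fun _ : ℕ => ℝ) p k (1:ℝ)))
    rw [map_add, map_smul] at this
    simp only [smul_eq_mul, ← hc] at this
    linarith
  have h0 := hmin.hasDerivAt_eq_zero hd4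
  have hP0 : P ≠ 0 := by linarith
  simp only [add_zero, add_sub_cancel_right, one_mul] at h0
  unfold psi
  have : P * |y k| ^ (P - 2) * y k * (1 / P) * (‖y‖ ^ P) ^ (1 / P - 1)
    = (‖y‖ ^ P) ^ (1 / P - 1) * (|y k| ^ (P - 2) * y k) := by field_simp
  rw [this] at h0
  linarith

lemma lp_J (hP : 1 < p.toReal) (y : lp (fun _ : ℕ => ℝ) p) :
    ∃ F : lp (fun _ : ℕ => ℝ) p →L[ℝ] ℝ, F y = ‖F‖ * ‖y‖ ∧
      ∀ k, F (lp.single p k (1:ℝ)) = psi p.toReal (y k) := by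
  by_cases hy : y = 0
  · exact ⟨0, by simp, fun k => by simp [hy, psi_zero]⟩
  obtain ⟨g, hg1, hg2⟩ := exists_dual_vector ℝ y (norm_ne_zero_iff.2 hy)
  have hd := lp_deriv hP g y hy (by rw [hg1, hg2]; simp)
  have hN : 0 < (‖y‖ ^ p.toReal) ^ (1 / p.toReal - 1) :=
    Real.rpow_pos_of_pos (Real.rpow_pos_of_pos (norm_pos_iff.2 hy) _) _
  set N := (‖y‖ ^ p.toReal) ^ (1 / p.toReal - 1)
  refine ⟨N⁻¹ • g, ?_, fun k => ?_⟩
  · rw [norm_smul, hg1, Real.norm_of_nonneg (inv_pos.2 hN).le]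
    simp [hg2]
  · simp only [smul_apply, hd k, hg1, smul_eq_mul]
    field_simp

end lpfacts

lemma lp_sum_apply {p : ℝ≥0∞} {ι : Type*} [Fintype ι] (z : ι → lp (fun _ : ℕ => ℝ) p)
    (c : ι → ℝ) (k : ℕ) : (∑ i, c i • z i : lp (fun _ : ℕ => ℝ) p) k = ∑ i, c i * z i k := by
  rw [lp.coeFn_sum, Finset.sum_apply]
  rfl

lemma su_of_disjoint {p : ℝ≥0∞} [Fact (1 ≤ p)] (hP : 1 < p.toReal) (hptop : p ≠ ⊤)
    (Y : Submodule ℝ (lp (fun _ : ℕ => ℝ) p)) {ι : Type*} [Fintype ι]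
    (z : ι → lp (fun _ : ℕ => ℝ) p) (hz : Submodule.span ℝ (Set.range z) = Y)
    (hz1 : ∀ i, ‖z i‖ = 1) (hd : ∀ i j, i ≠ j → ∀ k, z i k * z j k = 0) : PropSU Y := by
  classical
  choose J hJ hJk using fun i => lp_J hP (z i)
  have hzY : ∀ i, z i ∈ Y := fun i => hz ▸ Submodule.subset_span ⟨i, rfl⟩
  have hJij : ∀ i j, i ≠ j → J i (z j) = 0 := by
    intro i j hij
    have h := lp_hasSum hptop (J i) (z j)
    refine h.unique ?_
    convert hasSum_zero with k
    rw [hJk]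
    unfold psi
    have := hd i j hij k
    linear_combination |(z i) k| ^ (p.toReal - 2) * this
  have hJii : ∀ i, J i (z i) = 1 := by
    intro i
    have h := lp_hasSum hptop (J i) (z i)
    have h' := lp.hasSum_norm (by linarith : 0 < p.toReal) (z i)
    rw [hz1, Real.one_rpow] at h'
    refine h.unique ?_
    convert h' using 2 with k
    rw [hJk]
    unfold psi
    by_cases h0 : z i k = 0
    · simp [h0, Real.zero_rpow (by linarith : p.toReal ≠ 0)]
    · rw [Real.norm_eq_abs]
      have h1 : |z i k| ^ p.toReal = |z i k| ^ (p.toReal - 2) * |z i k| ^ 2 := by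
        rw [← Real.rpow_natCast, ← Real.rpow_add (abs_pos.2 h0)]
        congr 1; push_cast; ring
      rw [h1, sq_abs]; ring
  have happ : ∀ (c : ι → ℝ) x, (∑ i, c i • J i) x = ∑ i, c i * J i x := by
    intro c x
    simp
  have happz : ∀ (c : ι → ℝ) j, (∑ i, c i • J i) (z j) = c j := by
    intro c j
    rw [happ, Finset.sum_eq_single j (fun i _ hi => by rw [hJij i j hi, mul_zero]) (by simp),
      hJii, mul_one]
  refine ⟨Submodule.span ℝ (Set.range J), ?_, ?_, ?_⟩
  · have : FiniteDimensional ℝ (Submodule.span ℝ (Set.range J)) :=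
      FiniteDimensional.span_of_finite ℝ (Set.finite_range J)
    exact Submodule.closed_of_finiteDimensional _
  · constructor
    · rw [Submodule.disjoint_def]
      intro g hg hgY
      obtain ⟨c, rfl⟩ := (Submodule.mem_span_range_iff_exists_fun ℝ).1 hg
      have : ∀ i, c i = 0 := fun i => by rw [← happz c i]; exact hgY _ (hzY i)
      simp [this]
    · rw [codisjoint_iff, eq_top_iff]
      intro f _
      rw [Submodule.mem_sup]
      refine ⟨∑ i, f (z i) • J i, (Submodule.mem_span_range_iff_exists_fun ℝ).2 ⟨_, rfl⟩,
        f - ∑ i, f (z i) • J i, ?_, by abel⟩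
      intro y hy
      rw [← hz] at hy
      obtain ⟨c, rfl⟩ := (Submodule.mem_span_range_iff_exists_fun ℝ).1 hy
      rw [map_sum]
      refine Finset.sum_eq_zero fun j _ => ?_
      rw [map_smul, ContinuousLinearMap.sub_apply, happz (fun i => f (z i)) j, sub_self, smul_zero]
  · intro g hg h hh hh0
    obtain ⟨c, rfl⟩ := (Submodule.mem_span_range_iff_exists_fun ℝ).1 hg
    set g := ∑ i, c i • J i with hgdef
    by_cases hg0 : g = 0
    · rw [hg0]; simpa using hh0
    choose d hdd using psi_surj hP
    set y : lp (fun _ : ℕ => ℝ) p := ∑ i, d (c i) • z i with hy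
    have hyY : y ∈ Y := Submodule.sum_mem _ fun i _ => Submodule.smul_mem _ _ (hzY i)
    obtain ⟨F, hF, hFk⟩ := lp_J hP y
    have hFg : F = g := by
      apply lp_ext hptop
      intro k
      rw [hFk, happ, hy, lp_sum_apply,
        disj_sum (fun i => z i k) (fun i => d (c i)) (fun i j hij => hd i j hij k) _ (psi_zero _)]
      refine Finset.sum_congr rfl fun i _ => ?_
      rw [psi_mul, hdd, hJk]
    rw [hFg] at hF hFk
    clear_value g
    have hy0 : y ≠ 0 := by
      intro h0
      apply hg0
      apply lp_ext hptop
      intro k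
      rw [hFk, h0]
      simp [psi_zero]
    have hypos : 0 < ‖y‖ := norm_pos_iff.2 hy0
    have e1 : (g + h) y = ‖g‖ * ‖y‖ := by
      rw [← hF, ContinuousLinearMap.add_apply, hh y hyY, add_zero]
    have e2 : ‖g‖ * ‖y‖ ≤ ‖g + h‖ * ‖y‖ := by
      rw [← e1]; exact (le_abs_self _).trans ((g + h).le_opNorm y)
    have e3 : ‖g‖ ≤ ‖g + h‖ := le_of_mul_le_mul_right e2 hypos
    refine lt_of_le_of_ne e3 fun e4 => hh0 ?_
    have : g + h = g := by
      apply lp_ext hptop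
      intro k
      rw [lp_deriv hP g y hy0 hF k, lp_deriv hP (g + h) y hy0 (by rw [e1, e4]) k, e4]
    simpa using this

lemma disjoint_of_clarkson {p : ℝ≥0∞} [Fact (1 ≤ p)] (hP : 1 < p.toReal) (hP2 : p.toReal ≠ 2)
    (a b : lp (fun _ : ℕ => ℝ) p)
    (h : ‖a + b‖ ^ p.toReal + ‖a - b‖ ^ p.toReal
      = 2 * ‖a‖ ^ p.toReal + 2 * ‖b‖ ^ p.toReal) (k : ℕ) : a k * b k = 0 := by
  obtain ⟨ε, h0, h1, h2⟩ := clarkson_aux hP hP2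
  have hs := lp.hasSum_norm (p := p) (E := fun _ : ℕ => ℝ) (by linarith : 0 < p.toReal)
  have h3 := ((((hs (a + b)).add (hs (a - b))).sub ((hs a).mul_left 2)).sub
    ((hs b).mul_left 2)).mul_left ε
  have h4 : ε * (‖a + b‖ ^ p.toReal + ‖a - b‖ ^ p.toReal - 2 * ‖a‖ ^ p.toReal
    - 2 * ‖b‖ ^ p.toReal) = 0 := by rw [h]; ring
  rw [h4] at h3
  have h5 := (hasSum_zero_iff_of_nonneg (fun i => h1 (a i) (b i))).1 h3
  by_contra hk
  have := h2 _ _ hk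
  have h6 := congrFun h5 k
  simp only [Pi.zero_apply] at h6
  exact this.ne' h6

lemma iso_of_disjoint {p : ℝ≥0∞} [Fact (1 ≤ p)] (hP : 1 < p.toReal)
    (Y : Submodule ℝ (lp (fun _ : ℕ => ℝ) p)) [FiniteDimensional ℝ Y] {n : ℕ}
    (hn : n = Module.finrank ℝ Y)
    (z : Fin n → Y)
    (hz1 : ∀ i, ‖z i‖ = 1)
    (hd : ∀ i j, i ≠ j → ∀ k, (z i : lp (fun _ : ℕ => ℝ) p) k * (z j : lp (fun _ : ℕ => ℝ) p) k = 0) :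
    Nonempty (Y ≃ₗᵢ[ℝ] PiLp p (fun _ : Fin n => ℝ)) := by
  have hP0 : 0 < p.toReal := by linarith
  let T : PiLp p (fun _ : Fin n => ℝ) →ₗ[ℝ] Y :=
    { toFun := fun c => ∑ i, c i • z i
      map_add' := fun c d => by simp [add_smul, Finset.sum_add_distrib]
      map_smul' := fun r c => by simp [mul_smul, Finset.smul_sum] }
  have hT : ∀ c, ‖T c‖ = ‖c‖ := by
    intro c
    rw [PiLp.norm_eq_sum hP0]
    have h1 := lp.hasSum_norm hP0 (T c : lp (fun _ : ℕ => ℝ) p)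
    have h2 : HasSum (fun k => ∑ i, |c i| ^ p.toReal * ‖(z i : lp (fun _ : ℕ => ℝ) p) k‖ ^ p.toReal)
        (∑ i, |c i| ^ p.toReal * ‖(z i : lp (fun _ : ℕ => ℝ) p)‖ ^ p.toReal) :=
      hasSum_sum fun i _ => (lp.hasSum_norm hP0 (z i : lp (fun _ : ℕ => ℝ) p)).mul_left _
    have h3 : ‖(T c : lp (fun _ : ℕ => ℝ) p)‖ ^ p.toReal
      = ∑ i, |c i| ^ p.toReal * ‖(z i : lp (fun _ : ℕ => ℝ) p)‖ ^ p.toReal := by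
      refine h1.unique ?_
      convert h2 using 2 with k
      have e : (T c : lp (fun _ : ℕ => ℝ) p) = ∑ i, c i • (z i : lp (fun _ : ℕ => ℝ) p) := by
        show ((∑ i, c i • z i : Y) : lp (fun _ : ℕ => ℝ) p) = _
        simp
      rw [e, lp_sum_apply, disj_sum (fun i => (z i : lp (fun _ : ℕ => ℝ) p) k) (fun i => c i)
        (fun i j hij => hd i j hij k) (fun x => ‖x‖ ^ p.toReal) (by simp [hP0.ne'])]
      refine Finset.sum_congr rfl fun i _ => ?_
      rw [norm_mul, Real.mul_rpow (norm_nonneg _) (norm_nonneg _), Real.norm_eq_abs]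
    have h4 : ∀ i, ‖(z i : lp (fun _ : ℕ => ℝ) p)‖ = 1 := hz1
    simp only [h4, Real.one_rpow, mul_one] at h3
    simp only [Real.norm_eq_abs]
    rw [← h3, one_div, Real.rpow_rpow_inv (norm_nonneg _) hP0.ne']
    rfl
  let L : PiLp p (fun _ : Fin n => ℝ) →ₗᵢ[ℝ] Y := ⟨T, hT⟩
  refine ⟨(L.toLinearIsometryEquiv ?_).symm⟩
  rw [← hn, (WithLp.linearEquiv p ℝ (Fin n → ℝ)).finrank_eq]
  simp

lemma dim_abs {M W : Type*} [AddCommGroup M] [Module ℝ M] [AddCommGroup W] [Module ℝ W]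
    [FiniteDimensional ℝ W] {n : ℕ} (hn : Module.finrank ℝ W = n) (G : Submodule ℝ M)
    (r : M →ₗ[ℝ] W) (hr : ∀ f ∈ G, r f = 0 → f = 0) (v : M →ₗ[ℝ] (Fin n → ℝ))
    (g : Fin n → M) (hg : ∀ i, g i ∈ G) (hgv : ∀ i, v (g i) = Pi.single i 1) :
    ∀ f ∈ G, v f = 0 → f = 0 := by
  classical
  have hR : Function.Injective (r.comp G.subtype) := by
    rw [← LinearMap.ker_eq_bot, LinearMap.ker_eq_bot']
    intro g hg
    exact Subtype.ext (hr _ g.2 hg)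
  have : FiniteDimensional ℝ G := FiniteDimensional.of_injective _ hR
  have hdim : Module.finrank ℝ G ≤ n := by
    rw [← hn]
    exact LinearMap.finrank_le_finrank_of_injective hR
  have hVg : ∀ i, (v.comp G.subtype) ⟨g i, hg i⟩ = Pi.single i 1 := hgv
  have hVs : Function.Surjective (v.comp G.subtype) := by
    intro c
    refine ⟨∑ i, c i • ⟨g i, hg i⟩, ?_⟩
    rw [map_sum]
    simp only [map_smul, hVg]
    funext j
    simp [Finset.sum_apply, Pi.single_apply]
  have hVi : Function.Injective (v.comp G.subtype) := by
    have h1 : Module.finrank ℝ G = Module.finrank ℝ (Fin n → ℝ) := by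
      apply le_antisymm
      · simpa using hdim
      · exact LinearMap.finrank_le_finrank_of_surjective hVs
    exact (LinearMap.injective_iff_surjective_of_finrank_eq_finrank h1).2 hVs
  intro f hf h0
  have : (⟨f, hf⟩ : G) = 0 := hVi (by rw [map_zero]; exact h0)
  exact congrArg Subtype.val this

lemma dim_aux {X : Type*} [NormedAddCommGroup X] [NormedSpace ℝ X] (Y : Submodule ℝ X)
    [FiniteDimensional ℝ Y] (G : Submodule ℝ (X →L[ℝ] ℝ)) (hG : Disjoint G (annih Y))
    (x : Fin (Module.finrank ℝ Y) → X) (g : Fin (Module.finrank ℝ Y) → (X →L[ℝ] ℝ))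
    (hg : ∀ i, g i ∈ G) (hgx : ∀ i j, g i (x j) = (Pi.single i (1:ℝ) : _ → ℝ) j) :
    ∀ f ∈ G, (∀ j, f (x j) = 0) → f = 0 := by
  intro f hf h0
  exact dim_abs (M := X →L[ℝ] ℝ) (W := Module.Dual ℝ Y) (Subspace.dual_finrank_eq) G
    { toFun := fun g => (g : X →L[ℝ] ℝ).toLinearMap.comp Y.subtype
      map_add' := fun _ _ => rfl
      map_smul' := fun _ _ => rfl }
    (fun f hf h => (Submodule.disjoint_def.1 hG) f hf
      (fun y hy => LinearMap.congr_fun h (⟨y, hy⟩ : Y)))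
    { toFun := fun g j => (g : X →L[ℝ] ℝ) (x j)
      map_add' := fun _ _ => rfl
      map_smul' := fun _ _ => rfl }
    g hg (fun i => funext fun j => hgx i j) f hf (funext h0)

lemma disjoint_of_su {p : ℝ≥0∞} [Fact (1 ≤ p)] (hP : 1 < p.toReal) (hP2 : p.toReal ≠ 2)
    (Y : Submodule ℝ (lp (fun _ : ℕ => ℝ) p)) [FiniteDimensional ℝ Y] (h : PropSU Y) :
    ∃ z : Fin (Module.finrank ℝ Y) → Y, (∀ i, ‖z i‖ = 1) ∧
      ∀ i j, i ≠ j → ∀ k, (z i : lp (fun _ : ℕ => ℝ) p) k * (z j : lp (fun _ : ℕ => ℝ) p) k = 0 := by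
  classical
  obtain ⟨G, -, hG, hlt⟩ := h
  choose J hJ hJk using fun y : lp (fun _ : ℕ => ℝ) p => lp_J hP y
  have hJG : ∀ y ∈ Y, J y ∈ G := by
    intro y hy
    by_cases hy0 : y = 0
    · have : J y = 0 := by
        by_contra hne
        have ht : p ≠ ⊤ := by rintro rfl; simp at hP; linarith
        exact hne (lp_ext ht fun k => by rw [hJk, hy0]; simp [psi_zero])
      rw [this]; exact G.zero_mem
    have htop : J y ∈ G ⊔ annih Y := by rw [hG.sup_eq_top]; trivial
    obtain ⟨g, hg, h, hh, e⟩ := Submodule.mem_sup.1 htop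
    by_cases hh0 : h = 0
    · rw [← e, hh0, add_zero]; exact hg
    exfalso
    have h1 := hlt g hg h hh hh0
    rw [e] at h1
    have h2 := hJ y
    rw [← e, ContinuousLinearMap.add_apply, hh y hy, add_zero, e] at h2
    have h3 := (le_abs_self _).trans (g.le_opNorm y)
    rw [h2] at h3
    exact absurd (le_of_mul_le_mul_right h3 (norm_pos_iff.2 hy0)) (not_le.2 h1)
  -- coordinates
  let ev : ℕ → Module.Dual ℝ Y := fun k =>
    { toFun := fun y => (y : lp (fun _ : ℕ => ℝ) p) k
      map_add' := fun _ _ => rfl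
      map_smul' := fun _ _ => rfl }
  have hspan : ⊤ ≤ Submodule.span ℝ (Set.range ev) := by
    rw [top_le_iff]
    by_contra hne
    obtain ⟨φ, hφ0, hφ⟩ := Submodule.exists_le_ker_of_lt_top _ (lt_top_iff_ne_top.2 hne)
    obtain ⟨y, rfl⟩ := (Module.evalEquiv ℝ Y).surjective φ
    apply hφ0
    have : y = 0 := by
      apply Subtype.ext
      ext k
      exact hφ (Submodule.subset_span ⟨k, rfl⟩)
    rw [this, map_zero]
  let B0 := Module.Basis.ofSpan hspan
  have : Fintype ↑((linearIndepOn_empty ℝ id).extend (Set.empty_subset (Set.range ev))) :=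
    FiniteDimensional.fintypeBasisIndex B0
  have hcard : Fintype.card ↑((linearIndepOn_empty ℝ id).extend (Set.empty_subset (Set.range ev)))
      = Module.finrank ℝ Y := by
    rw [← Module.finrank_eq_card_basis B0, Subspace.dual_finrank_eq]
  let B := B0.reindex (Fintype.equivFinOfCardEq hcard)
  have hB : ∀ i, ∃ k, ev k = B i := by
    intro i
    have : B i ∈ Set.range B0 := by simp [B]
    exact Module.Basis.ofSpan_subset hspan this
  choose κ hκ using hB
  let S : Y →ₗ[ℝ] (Fin (Module.finrank ℝ Y) → ℝ) := LinearMap.pi fun i => B i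
  have hS : Function.Injective S := by
    rw [← LinearMap.ker_eq_bot, LinearMap.ker_eq_bot']
    intro y hy
    have h0 : ∀ f : Module.Dual ℝ Y, f y = 0 := by
      intro f
      rw [← B.sum_repr f, LinearMap.sum_apply]
      refine Finset.sum_eq_zero fun i _ => ?_
      have : B i y = 0 := congrFun hy i
      simp [this]
    apply Subtype.ext
    ext k
    exact h0 (ev k)
  have hSs : Function.Surjective S := (LinearMap.injective_iff_surjective_of_finrank_eq_finrank
    (by simp)).1 hS
  choose w hw using fun i => hSs (Pi.single i 1)
  have hwk : ∀ i j, (w i : lp (fun _ : ℕ => ℝ) p) (κ j) = (Pi.single i (1:ℝ) : _ → ℝ) j := by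
    intro i j
    rw [← hw i]
    show ev (κ j) (w i) = B j (w i)
    rw [hκ]
  have hVg : ∀ i j, J (w i) (lp.single p (κ j) (1:ℝ))
      = (Pi.single i (1:ℝ) : Fin (Module.finrank ℝ Y) → ℝ) j := by
    intro i j
    rw [hJk, hwk]
    by_cases hij : j = i
    · subst hij; simp [psi_one]
    · simp [hij, psi_zero]
  have hVi := dim_aux Y G hG.disjoint (fun j => lp.single p (κ j) (1:ℝ)) (fun i => J (w i))
    (fun i => hJG _ (w i).2) hVg
  have hadd : ∀ i j, i ≠ j → ∀ t k, psi p.toReal ((w i : lp (fun _ : ℕ => ℝ) p) k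
      + t * (w j : lp (fun _ : ℕ => ℝ) p) k) = psi p.toReal ((w i : lp (fun _ : ℕ => ℝ) p) k)
      + psi p.toReal t * psi p.toReal ((w j : lp (fun _ : ℕ => ℝ) p) k) := by
    intro i j hij t k
    have hc : ∀ k, ((w i + t • w j : Y) : lp (fun _ : ℕ => ℝ) p) k =
      (w i : lp (fun _ : ℕ => ℝ) p) k + t * (w j : lp (fun _ : ℕ => ℝ) p) k := fun k => rfl
    have e : J (w i + t • w j : Y) - (J (w i) + psi p.toReal t • J (w j)) = 0 := by
      refine hVi _ (G.sub_mem (hJG _ (w i + t • w j : Y).2)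
        (G.add_mem (hJG _ (w i).2) (G.smul_mem _ (hJG _ (w j).2)))) fun l => ?_
      show J (w i + t • w j : Y) (lp.single p (κ l) (1:ℝ)) - (J (w i) (lp.single p (κ l) (1:ℝ))
        + psi p.toReal t * J (w j) (lp.single p (κ l) (1:ℝ))) = 0
      rw [hVg, hVg, hJk, hc, hwk, hwk]
      by_cases hli : l = i
      · subst hli; simp [hij, psi_one]
      · by_cases hlj : l = j
        · subst hlj; simp [hli]
        · simp [hli, hlj, psi_zero]
    have e2 := congrArg (fun f : lp (fun _ : ℕ => ℝ) p →L[ℝ] ℝ => f (lp.single p k (1:ℝ)))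
      (sub_eq_zero.1 e)
    change J (w i + t • w j : Y) (lp.single p k (1:ℝ)) = J (w i) (lp.single p k (1:ℝ))
      + psi p.toReal t * J (w j) (lp.single p k (1:ℝ)) at e2
    rwa [hJk, hJk, hJk, hc] at e2
  have hdisj : ∀ i j, i ≠ j → ∀ k,
      (w i : lp (fun _ : ℕ => ℝ) p) k * (w j : lp (fun _ : ℕ => ℝ) p) k = 0 := by
    intro i j hij k
    by_contra hne
    obtain ⟨hu, hv⟩ := mul_ne_zero_iff.1 hne
    have := hadd i j hij ((w i : lp (fun _ : ℕ => ℝ) p) k / (w j : lp (fun _ : ℕ => ℝ) p) k) k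
    rw [← psi_mul, div_mul_cancel₀ _ hv, ← two_mul, ← two_mul, psi_mul] at this
    exact psi_two hP2 (mul_right_cancel₀ (psi_ne_zero _ hu) this)
  have hw0 : ∀ i, w i ≠ 0 := by
    intro i h0
    have := hw i
    rw [h0, map_zero] at this
    have := congrFun this i
    simp at this
  refine ⟨fun i => ‖w i‖⁻¹ • w i, fun i => ?_, fun i j hij k => ?_⟩
  · rw [norm_smul, norm_inv, norm_norm, inv_mul_cancel₀ (norm_ne_zero_iff.2 (hw0 i))]
  · show (‖w i‖⁻¹ * (w i : lp (fun _ : ℕ => ℝ) p) k) * (‖w j‖⁻¹ * (w j : lp (fun _ : ℕ => ℝ) p) k) = 0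
    linear_combination ‖w i‖⁻¹ * ‖w j‖⁻¹ * hdisj i j hij k

theorem stmt16 (p : ℝ≥0∞) [Fact (1 ≤ p)] (hp1 : 1 < p) (hptop : p ≠ ⊤) (hp2 : p ≠ 2)
    (Y : Submodule ℝ (lp (fun _ : ℕ => ℝ) p)) [FiniteDimensional ℝ Y] :
    PropSU Y ↔
      Nonempty (Y ≃ₗᵢ[ℝ] PiLp p (fun _ : Fin (Module.finrank ℝ Y) => ℝ)) := by
  have hP : 1 < p.toReal := by
    have := (ENNReal.toReal_lt_toReal ENNReal.one_ne_top hptop).2 hp1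
    simpa using this
  have hP2 : p.toReal ≠ 2 := by
    intro h
    apply hp2
    rw [← ENNReal.ofReal_toReal hptop, h]
    simp
  have hP0 : 0 < p.toReal := by linarith
  constructor
  · intro h
    obtain ⟨z, hz1, hd⟩ := disjoint_of_su hP hP2 Y h
    exact iso_of_disjoint hP Y rfl z hz1 hd
  · rintro ⟨T⟩
    let e : Fin (Module.finrank ℝ Y) → PiLp p (fun _ : Fin (Module.finrank ℝ Y) => ℝ) :=
      fun i => WithLp.toLp p (Pi.single i (1:ℝ))
    let z : Fin (Module.finrank ℝ Y) → Y := fun i => T.symm (e i)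
    have hn : ∀ v, ‖v‖ ^ p.toReal = ∑ i, |T v i| ^ p.toReal := by
      intro v
      rw [← T.norm_map, PiLp.norm_eq_sum hP0, one_div, Real.rpow_inv_rpow _ hP0.ne']
      · rfl
      · exact Finset.sum_nonneg fun i _ => Real.rpow_nonneg (norm_nonneg _) _
    have hnz : ∀ i, ‖z i‖ = 1 := by
      intro i
      simp [z, e]
    refine su_of_disjoint hP hptop Y (fun i => (z i : lp (fun _ : ℕ => ℝ) p)) ?_ hnz ?_
    · apply le_antisymm
      · rw [Submodule.span_le]
        rintro _ ⟨i, rfl⟩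
        exact (z i).2
      · intro y hy
        rw [Submodule.mem_span_range_iff_exists_fun]
        refine ⟨fun i => T ⟨y, hy⟩ i, ?_⟩
        have : (∑ i, (T ⟨y, hy⟩ i) • z i) = ⟨y, hy⟩ := by
          apply T.injective
          rw [map_sum]
          ext j
          simp [z, e, Pi.single_apply]
        simpa using congrArg (Subtype.val) this
    · intro i j hij k
      apply disjoint_of_clarkson hP hP2
      have h2 : ∀ s : ℝ, |s| = 1 → ‖z i + s • z j‖ ^ p.toReal = 2 := by
        intro s hs
        rw [hn]
        have : ∀ l, |T (z i + s • z j) l| ^ p.toReal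
            = (if l = i then 1 else 0) + (if l = j then 1 else 0) := by
          intro l
          by_cases hli : l = i
          · subst hli; simp [z, e, hij]
          · by_cases hlj : l = j
            · subst hlj; simp [z, e, hli, hs]
            · simp [z, e, hli, hlj, hP0.ne']
        simp only [this, Finset.sum_add_distrib]
        simp; norm_num
      have h3 := h2 1 (by simp)
      have h4 := h2 (-1) (by simp)
      rw [one_smul] at h3
      rw [neg_smul, one_smul, ← sub_eq_add_neg] at h4
      have h5 : ∀ i, ‖(z i : lp (fun _ : ℕ => ℝ) p)‖ = 1 := hnz
      change ‖(z i : lp (fun _ : ℕ => ℝ) p) + z j‖ ^ p.toReal = 2 at h3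
      change ‖(z i : lp (fun _ : ℕ => ℝ) p) - z j‖ ^ p.toReal = 2 at h4
      rw [h3, h4, h5, h5]
      simp

end
end

section
/- Let Y be a closed linear subspace of ℓ₁ of codimension 1. Then Y does not have property-(SU) in ℓ₁. -/
open scoped ENNReal

noncomputable section

abbrev EL1 := lp (fun _ : ℕ => ℝ) 1

def eu (i : ℕ) : EL1 := lp.single 1 i (1 : ℝ)

def Pc (i : ℕ) : EL1 →L[ℝ] ℝ := lp.evalCLM ℝ (fun _ : ℕ => ℝ) 1 i

lemma Pc_eu (i j : ℕ) : Pc i (eu j) = if i = j then 1 else 0 := by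
  change (lp.single 1 j (1 : ℝ) : EL1) i = _
  rw [lp.single_apply, Pi.single_apply]

lemma abs_le_opnorm (f : EL1 →L[ℝ] ℝ) (i : ℕ) : |f (eu i)| ≤ ‖f‖ := by
  have h := f.le_opNorm (eu i)
  have h1 : ‖eu i‖ = 1 := by
    unfold eu
    rw [lp.norm_single (by norm_num)]; simp
  rwa [h1, mul_one, Real.norm_eq_abs] at h

lemma opnorm_le (f : EL1 →L[ℝ] ℝ) (M : ℝ) (h : ∀ i, |f (eu i)| ≤ M) : ‖f‖ ≤ M := by
  have hM : 0 ≤ M := (abs_nonneg _).trans (h 0)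
  refine f.opNorm_le_bound hM fun x => ?_
  have h1 : HasSum (fun i => f (lp.single 1 i (x i))) (f x) :=
    (lp.hasSum_single (by norm_num) x).mapL f
  have h2 : HasSum (fun i => ‖x i‖) ‖x‖ := by
    have := lp.hasSum_norm (p := 1) (by norm_num) x
    simpa using this
  have h3 : ∀ i, ‖f (lp.single 1 i (x i))‖ ≤ M * ‖x i‖ := by
    intro i
    have : (lp.single 1 i (x i) : EL1) = (x i) • eu i := by
      unfold eu
      rw [← lp.single_smul]; simp
    rw [this, map_smul, norm_smul, mul_comm]
    exact mul_le_mul_of_nonneg_right (h i) (norm_nonneg _)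
  have h4 := h2.mul_left M
  rw [← h1.tsum_eq, ← h4.tsum_eq]
  exact tsum_of_norm_bounded h4.summable.hasSum h3

lemma ex_ann (Y : Submodule ℝ EL1) (hY : IsClosed (Y : Set EL1))
    (hcodim : Module.finrank ℝ (EL1 ⧸ Y) = 1) :
    ∃ a ∈ annih Y, a ≠ 0 ∧ ∀ h ∈ annih Y, ∃ c : ℝ, h = c • a := by
  obtain ⟨w, hw, hall⟩ := finrank_eq_one_iff'.1 hcodim
  obtain ⟨v, rfl⟩ := Submodule.Quotient.mk_surjective Y w
  have hv : v ∉ Y := fun hv => hw ((Submodule.Quotient.mk_eq_zero Y).2 hv)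
  obtain ⟨a, u, h1, h2⟩ := geometric_hahn_banach_closed_point Y.convex hY hv
  have h0 : 0 < u := by simpa using h1 0 Y.zero_mem
  have hav : a v ≠ 0 := (h0.trans h2).ne'
  have ha : a ∈ annih Y := by
    intro y hy
    by_contra hne
    have := h1 ((u / a y) • y) (Y.smul_mem _ hy)
    rw [map_smul, smul_eq_mul, div_mul_cancel₀ _ hne] at this
    exact lt_irrefl _ this
  refine ⟨a, ha, fun h => hav (by simp [h]), fun h hh => ⟨h v / a v, ?_⟩⟩
  ext x
  obtain ⟨c, hc⟩ := hall (Submodule.Quotient.mk x)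
  rw [← Submodule.Quotient.mk_smul, Submodule.Quotient.eq] at hc
  have e1 := hh _ hc
  have e2 := ha _ hc
  simp only [map_sub, map_smul, smul_eq_mul] at e1 e2
  simp only [ContinuousLinearMap.smul_apply, smul_eq_mul]
  have e3 : h x = c * h v := by linarith
  have e4 : a x = c * a v := by linarith
  rw [e3, e4]; field_simp

theorem stmt19 (Y : Submodule ℝ (lp (fun _ : ℕ => ℝ) 1)) (hY : IsClosed (Y : Set (lp (fun _ : ℕ => ℝ) 1)))
    (hcodim : Module.finrank ℝ (lp (fun _ : ℕ => ℝ) 1 ⧸ Y) = 1) :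
    ¬ PropSU Y := by
  rintro ⟨G, -, hc, hG⟩
  obtain ⟨a, ha, ha0, hspan⟩ := ex_ann Y hY hcodim
  obtain ⟨s, hs, hsa⟩ : ∃ s : ℕ → ℝ, (∀ i, s i = 1 ∨ s i = -1) ∧ ∀ i, 0 ≤ s i * a (eu i) := by
    refine ⟨fun i => if 0 ≤ a (eu i) then 1 else -1, fun i => ?_, fun i => ?_⟩
    · dsimp only; split_ifs <;> simp
    · dsimp only; split_ifs <;> linarith
  have hs2 : ∀ i, s i * s i = 1 := fun i => by rcases hs i with h | h <;> rw [h] <;> norm_num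
  have hsab : ∀ i x, |s i * x| = |x| := fun i x => by rcases hs i with h | h <;> simp [h]
  have hsabs : ∀ i, |s i| = 1 := fun i => by rcases hs i with h | h <;> simp [h]
  have key : ∀ i j, i ≠ j → s i • Pc i - s j • Pc j ∈ G := by
    intro i j hij
    obtain ⟨g, hg, h, hh, hgh⟩ := Submodule.mem_sup.1
      ((hc.sup_eq_top).symm ▸ Submodule.mem_top : s i • Pc i - s j • Pc j ∈ G ⊔ annih Y)
    by_cases h0 : h = 0
    · rw [← hgh, h0, add_zero]; exact hg
    exfalso
    have hlt := hG g hg h hh h0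
    obtain ⟨c, rfl⟩ := hspan h hh
    have hD : ‖g + c • a‖ ≤ 1 := by
      rw [hgh]
      refine opnorm_le _ _ fun k => ?_
      simp only [ContinuousLinearMap.sub_apply, ContinuousLinearMap.smul_apply, Pc_eu, smul_eq_mul]
      by_cases h1 : i = k
      · subst h1; simp [hij.symm, hsabs]
      · by_cases h2 : j = k
        · subst h2; simp [hij, hsabs]
        · simp [h1, h2]
    have gi := abs_le_opnorm g i
    have gj := abs_le_opnorm g j
    have ei := congrArg (fun f : EL1 →L[ℝ] ℝ => f (eu i)) hgh
    have ej := congrArg (fun f : EL1 →L[ℝ] ℝ => f (eu j)) hgh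
    simp only [ContinuousLinearMap.sub_apply, ContinuousLinearMap.add_apply,
      ContinuousLinearMap.smul_apply, Pc_eu, smul_eq_mul, if_neg hij, if_neg hij.symm,
      if_true] at ei ej
    rw [← hsab i] at gi
    rw [← hsab j] at gj
    have gi' := (le_abs_self _).trans gi
    have gj' := (neg_le_abs _).trans gj
    have ei' : s i * g (eu i) = 1 - c * (s i * a (eu i)) := by
      linear_combination s i * ei + hs2 i
    have ej' : s j * g (eu j) = -1 - c * (s j * a (eu j)) := by
      linear_combination s j * ej - hs2 j
    rcases le_total c 0 with h | h
    · have := mul_nonneg (neg_nonneg.2 h) (hsa i)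
      linarith
    · have := mul_nonneg h (hsa j)
      linarith
  have hmem := G.add_mem (key 0 1 (by norm_num)) (key 0 2 (by norm_num))
  have hapos : 0 < ‖a‖ := norm_pos_iff.2 ha0
  have hne : -(1 / ‖a‖) • a ≠ 0 := by
    refine smul_ne_zero ?_ ha0
    simp [ha0]
  have hlt := hG _ hmem _ ((annih Y).smul_mem (-(1 / ‖a‖)) ha) hne
  have hlow : 2 ≤ ‖s 0 • Pc 0 - s 1 • Pc 1 + (s 0 • Pc 0 - s 2 • Pc 2)‖ := by
    refine le_trans ?_ (abs_le_opnorm _ 0)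
    rw [← hsab 0]
    refine le_trans ?_ (le_abs_self _)
    simp [Pc_eu]
    linarith [hs2 0]
  refine absurd (hlow.trans_lt hlt) (not_lt.2 (opnorm_le _ _ fun k => ?_))
  have hk : |1 / ‖a‖ * a (eu k)| ≤ 1 := by
    rw [abs_mul, abs_of_pos (by positivity), one_div, inv_mul_le_iff₀ hapos, mul_one]
    exact abs_le_opnorm a k
  have hk0 : 0 ≤ s k * (1 / ‖a‖ * a (eu k)) := by
    have := mul_nonneg (by positivity : 0 ≤ 1 / ‖a‖) (hsa k)
    linarith
  rw [← hsab k]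
  have hk1 : |s k * (1 / ‖a‖ * a (eu k))| ≤ 1 := by rw [hsab]; exact hk
  generalize hq : 1 / ‖a‖ * a (eu k) = q at *
  simp only [ContinuousLinearMap.sub_apply, ContinuousLinearMap.add_apply,
      ContinuousLinearMap.smul_apply, Pc_eu, smul_eq_mul, neg_mul, hq]
  rw [abs_le] at hk1 ⊢
  have := hs2 k
  by_cases h0 : 0 = k
  · subst h0
    norm_num
    constructor <;> nlinarith
  by_cases h1 : 1 = k
  · subst h1
    norm_num
    constructor <;> nlinarith
  by_cases h2 : 2 = k
  · subst h2
    norm_num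
    constructor <;> nlinarith
  simp [h0, h1, h2]
  constructor <;> nlinarith

end
end
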